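/- Over a two-letter alphabet Σ = {a, b}: (i) there exists a complete NBW over Σ that is limit deterministic for some partition but is not finitely ambiguous; and (ii) there exists a complete NBW over Σ that is finitely ambiguous but is not limit deterministic for any partition. Hence the classes of complete limit deterministic NBWs and of complete finitely ambiguous NBWs are incomparable. -/

import Mathlib

open scoped Classical

/-- A nondeterministic Büchi automaton on ω-words with states `Q` over alphabet `σ`. -/
structure NBW (σ : Type) (Q : Type) where
  init : Set Q
  trans : Q → σ → Set Q
  acc : Set Q

namespace NBW

variable {σ Q : Type}

/-- `ρ` is a run of `A` on the ω-word `w`. -/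
def IsRun (A : NBW σ Q) (w : ℕ → σ) (ρ : ℕ → Q) : Prop :=
  ρ 0 ∈ A.init ∧ ∀ i, ρ (i + 1) ∈ A.trans (ρ i) (w i)

/-- `ρ` is an accepting run of `A` on `w`: it visits `A.acc` infinitely often. -/
def IsAccRun (A : NBW σ Q) (w : ℕ → σ) (ρ : ℕ → Q) : Prop :=
  A.IsRun w ρ ∧ ∀ n, ∃ m, n ≤ m ∧ ρ m ∈ A.acc

/-- The ω-language accepted by `A`. -/
def Lang (A : NBW σ Q) : Set (ℕ → σ) := {w | ∃ ρ, A.IsAccRun w ρ}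

/-- `A` is complete: every state has a successor on every letter. -/
def Complete (A : NBW σ Q) : Prop := ∀ q a, (A.trans q a).Nonempty

/-- `A` is finitely ambiguous: every accepted word has finitely many accepting runs. -/
def FinitelyAmbiguous (A : NBW σ Q) : Prop :=
  ∀ w ∈ A.Lang, {ρ | A.IsAccRun w ρ}.Finite

/-- `A` is limit deterministic with partition `(QN, QD)`. -/
def LimitDetPart (A : NBW σ Q) (QN QD : Set Q) : Prop :=
  Disjoint QN QD ∧ QN ∪ QD = Set.univ ∧ A.acc ⊆ QD ∧
    ∀ q ∈ QD, ∀ a, ∃ q' ∈ QD, A.trans q a = {q'}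

/-- `A` is limit deterministic (for some partition). -/
def LimitDet (A : NBW σ Q) : Prop := ∃ QN QD, A.LimitDetPart QN QD

end NBW

/-- Over a two-letter alphabet, the classes of complete limit deterministic NBWs and
of complete finitely ambiguous NBWs are incomparable. -/
theorem NBW.ldbw_fanbw_incomparable :
    (∃ (n : ℕ) (A : NBW Bool (Fin n)),
        A.Complete ∧ A.LimitDet ∧ ¬ A.FinitelyAmbiguous) ∧
    (∃ (n : ℕ) (A : NBW Bool (Fin n)),
        A.Complete ∧ A.FinitelyAmbiguous ∧ ¬ A.LimitDet) := by
  refine ⟨⟨2, ⟨{0}, fun q _ => {p | q ≤ p}, {1}⟩, ?_, ?_, ?_⟩,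
    ⟨2, ⟨{0}, fun q _ => {p | q ≤ p}, {0}⟩, ?_, ?_, ?_⟩⟩
  · intro q a
    exact ⟨q, le_refl q⟩
  · refine ⟨{0}, {1}, by simp, ?_, subset_rfl, ?_⟩
    · ext q
      fin_cases q <;> simp
    · rintro q rfl a
      refine ⟨1, rfl, ?_⟩
      ext p
      fin_cases p <;> simp
  · intro h
    -- the run that jumps from state 0 to state 1 after `k + 1` steps
    have key : ∀ k : ℕ, NBW.IsAccRun (σ := Bool) (Q := Fin 2)
        ⟨{0}, fun q _ => {p | q ≤ p}, {1}⟩ (fun _ => true)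
        (fun i => if i ≤ k then 0 else 1) := by
      intro k
      refine ⟨⟨by simp, fun i => ?_⟩, fun n => ⟨n + k + 1, by omega, ?_⟩⟩
      · show (if i ≤ k then (0 : Fin 2) else 1) ≤ (if i + 1 ≤ k then (0 : Fin 2) else 1)
        by_cases h1 : i ≤ k
        · simp [h1]
        · have h2 : ¬ i + 1 ≤ k := by omega
          simp [h1, h2]
      · have h2 : ¬ n + k + 1 ≤ k := by omega
        simp [h2]
    have hfin := h (fun _ => true) ⟨_, key 0⟩
    refine Set.infinite_of_injective_forall_mem (f := fun (k : ℕ) (i : ℕ) =>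
      if i ≤ k then (0 : Fin 2) else 1) ?_ key hfin
    intro k l hkl
    have h1 := congrFun hkl k
    have h2 := congrFun hkl l
    simp at h1 h2
    omega
  · intro q a
    exact ⟨q, le_refl q⟩
  · intro w _
    refine (Set.finite_singleton (fun _ => (0 : Fin 2))).subset ?_
    rintro ρ ⟨⟨_, hs⟩, hacc⟩
    have hmono : Monotone ρ := monotone_nat_of_le_succ hs
    funext n
    obtain ⟨m, hm, h0⟩ := hacc n
    have h0' : ρ m = 0 := h0
    have := hmono hm
    rw [h0'] at this
    exact le_antisymm this (Fin.zero_le _)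
  · rintro ⟨QN, QD, _, _, hacc, hdet⟩
    obtain ⟨q', _, hq⟩ := hdet 0 (hacc rfl) true
    have h0 : (0 : Fin 2) ∈ ({q'} : Set (Fin 2)) := hq ▸ le_refl (0 : Fin 2)
    have h1 : (1 : Fin 2) ∈ ({q'} : Set (Fin 2)) := hq ▸ Fin.zero_le (1 : Fin 2)
    have h2 : (0 : Fin 2) = 1 := Eq.trans h0 (Eq.symm h1)
    exact absurd h2 (by decide)
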